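/- arXiv:2003.01946 — 3 statements merged into one kernel-verified Lean document; each statement's English description precedes it below -/
import Mathlib

section
/- Let Q be a real symmetric positive semidefinite n×n matrix and A an m×n real matrix with orthonormal rows whose row space intersects ker Q trivially, and set P_A = Aᵀ (A Q Aᵀ)⁻¹ A Q. If in addition the rank of Q equals m, then the kernel of P_A equals the kernel of Q. -/
open Matrix

/-- With `Q` real symmetric positive semidefinite, `A` with orthonormal rows and row space
intersecting `ker Q` trivially, and `P_A = Aᵀ (A Q Aᵀ)⁻¹ A Q`: if moreover the rank of `Q`
equals `m`, then the kernel of `P_A` equals the kernel of `Q`. -/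
theorem ker_obliqueProjection_eq_ker_Q
    {n m : ℕ} (Q : Matrix (Fin n) (Fin n) ℝ) (A : Matrix (Fin m) (Fin n) ℝ)
    (hQsymm : Q.IsSymm) (hQ : Q.PosSemidef)
    (hA : A * Aᵀ = 1)
    (hker : LinearMap.range Aᵀ.mulVecLin ⊓ LinearMap.ker Q.mulVecLin = ⊥)
    (hrank : Q.rank = m) :
    LinearMap.ker (Aᵀ * (A * Q * Aᵀ)⁻¹ * A * Q).mulVecLin = LinearMap.ker Q.mulVecLin := by
  have hB : IsUnit (A * Q * Aᵀ) := by
    rw [← Matrix.mulVec_injective_iff_isUnit]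
    rw [← Matrix.coe_mulVecLin, ← LinearMap.ker_eq_bot, LinearMap.ker_eq_bot']
    intro v hv
    rw [Matrix.mulVecLin_apply] at hv
    have h1 : star (Aᵀ *ᵥ v) ⬝ᵥ (Q *ᵥ (Aᵀ *ᵥ v)) = 0 := by
      have h2 : v ⬝ᵥ ((A * Q * Aᵀ) *ᵥ v) = 0 := by rw [hv, dotProduct_zero]
      rw [star_trivial, Matrix.mulVec_transpose, ← Matrix.dotProduct_mulVec,
        ← Matrix.mulVec_transpose, Matrix.mulVec_mulVec, Matrix.mulVec_mulVec]
      exact h2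
    have h3 := (hQ.dotProduct_mulVec_zero_iff _).1 h1
    have h4 : Aᵀ *ᵥ v ∈ LinearMap.range Aᵀ.mulVecLin ⊓ LinearMap.ker Q.mulVecLin :=
      ⟨⟨v, rfl⟩, h3⟩
    rw [hker, Submodule.mem_bot] at h4
    have h5 : A *ᵥ (Aᵀ *ᵥ v) = v := by
      rw [Matrix.mulVec_mulVec, hA, Matrix.one_mulVec]
    rw [← h5, h4, Matrix.mulVec_zero]
  have hdet := (Matrix.isUnit_iff_isUnit_det _).1 hB
  set P := Aᵀ * (A * Q * Aᵀ)⁻¹ * A * Q with hP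
  have hone : A * P * Aᵀ = 1 := by
    calc A * P * Aᵀ = (A * Aᵀ) * ((A * Q * Aᵀ)⁻¹ * (A * Q * Aᵀ)) := by
          simp only [hP, Matrix.mul_assoc]
      _ = 1 := by rw [hA, Matrix.nonsing_inv_mul _ hdet, Matrix.one_mul]
  have hr : m ≤ P.rank := by
    have h1 : (A * P * Aᵀ).rank = m := by rw [hone, Matrix.rank_one, Fintype.card_fin]
    calc m = (A * P * Aᵀ).rank := h1.symm
      _ ≤ (A * P).rank := Matrix.rank_mul_le_left _ _
      _ ≤ P.rank := Matrix.rank_mul_le_right _ _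
  symm
  apply Submodule.eq_of_le_of_finrank_le
  · intro x hx
    rw [LinearMap.mem_ker, Matrix.mulVecLin_apply] at hx ⊢
    rw [hP, ← Matrix.mulVec_mulVec, hx, Matrix.mulVec_zero]
  · have e1 := LinearMap.finrank_range_add_finrank_ker P.mulVecLin
    have e2 := LinearMap.finrank_range_add_finrank_ker Q.mulVecLin
    unfold Matrix.rank at hr hrank
    omega
end

section
/- Let Q be a real symmetric positive semidefinite n×n matrix. Let A be an m×n real matrix and B a (n−m)×n real matrix such that A Aᵀ = I_m, B Bᵀ = I_{n−m} and Aᵀ A + Bᵀ B = I_n (so the rows of A and B together form an orthonormal basis of ℝⁿ, the rows of B spanning the orthogonal complement of the row space of A), and suppose the row space of A intersects ker Q trivially. Set P_A = Aᵀ (A Q Aᵀ)⁻¹ A Q. Then for every vector y ∈ ℝⁿ: B y = 0 if and only if P_A y = y. (Placing the linear constraints B y = 0 is equivalent to y being a fixed point of the oblique projection P_A.) -/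
open Matrix

/-- Let `Q` be real symmetric positive semidefinite, and let `A` (size `m × n`) and `B`
(size `(n-m) × n`) satisfy `A Aᵀ = 1`, `B Bᵀ = 1` and `Aᵀ A + Bᵀ B = 1` (so the rows of
`A` and `B` together form an orthonormal basis of `ℝⁿ`, the rows of `B` spanning the
orthogonal complement of the row space of `A`), with the row space of `A` intersecting
`ker Q` trivially.  With `P_A = Aᵀ (A Q Aᵀ)⁻¹ A Q`, for every `y : B y = 0 ↔ P_A y = y`. -/
theorem constraints_iff_fixedPoint
    {n m : ℕ} (Q : Matrix (Fin n) (Fin n) ℝ) (A : Matrix (Fin m) (Fin n) ℝ)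
    (B : Matrix (Fin (n - m)) (Fin n) ℝ)
    (hQsymm : Q.IsSymm) (hQ : Q.PosSemidef)
    (hA : A * Aᵀ = 1) (hB : B * Bᵀ = 1) (hAB : Aᵀ * A + Bᵀ * B = 1)
    (hker : LinearMap.range Aᵀ.mulVecLin ⊓ LinearMap.ker Q.mulVecLin = ⊥) :
    ∀ y : Fin n → ℝ,
      B.mulVec y = 0 ↔ (Aᵀ * (A * Q * Aᵀ)⁻¹ * A * Q).mulVec y = y := by
  have hBA : B * Aᵀ = 0 := by
    have h1 : Bᵀ * B * Aᵀ = 0 := by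
      have h := congrArg (fun M => M * Aᵀ) hAB
      simp only [Matrix.add_mul, Matrix.one_mul] at h
      rw [Matrix.mul_assoc Aᵀ A, hA, Matrix.mul_one] at h
      simpa using h
    calc B * Aᵀ = B * Bᵀ * B * Aᵀ := by rw [hB, Matrix.one_mul]
      _ = B * (Bᵀ * B * Aᵀ) := by simp only [Matrix.mul_assoc]
      _ = 0 := by rw [h1, Matrix.mul_zero]
  have hinj : ∀ v : Fin m → ℝ, (A * Q * Aᵀ) *ᵥ v = 0 → v = 0 := by
    intro v hv
    have h0 : star (Aᵀ *ᵥ v) ⬝ᵥ (Q *ᵥ (Aᵀ *ᵥ v)) = 0 := by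
      have h2 : v ⬝ᵥ ((A * Q * Aᵀ) *ᵥ v) = 0 := by rw [hv, dotProduct_zero]
      rw [← h2, star_trivial, Matrix.mulVec_transpose, ← Matrix.dotProduct_mulVec,
        ← Matrix.mulVec_transpose]
      simp only [Matrix.mulVec_mulVec, Matrix.mul_assoc]
    have h3 : Q *ᵥ (Aᵀ *ᵥ v) = 0 := (hQ.dotProduct_mulVec_zero_iff _).1 h0
    have h4 : Aᵀ *ᵥ v ∈ LinearMap.range Aᵀ.mulVecLin ⊓ LinearMap.ker Q.mulVecLin :=
      ⟨⟨v, rfl⟩, h3⟩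
    rw [hker, Submodule.mem_bot] at h4
    have h5 : A *ᵥ (Aᵀ *ᵥ v) = v := by rw [Matrix.mulVec_mulVec, hA, Matrix.one_mulVec]
    rw [← h5, h4, Matrix.mulVec_zero]
  have hunit : IsUnit (A * Q * Aᵀ) := by
    rw [← Matrix.mulVec_injective_iff_isUnit]
    intro v w hvw
    have h := hinj (v - w) (by rw [Matrix.mulVec_sub]; exact sub_eq_zero.2 hvw)
    exact sub_eq_zero.1 h
  have hdet := (Matrix.isUnit_iff_isUnit_det _).1 hunit
  intro y
  constructor
  · intro hy
    have h1 : Aᵀ *ᵥ (A *ᵥ y) = y := by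
      have h := congrArg (fun M => M *ᵥ y) hAB
      simp only [Matrix.add_mulVec, Matrix.one_mulVec, ← Matrix.mulVec_mulVec, hy,
        Matrix.mulVec_zero, add_zero] at h
      exact h
    have h2 : Aᵀ * (A * Q * Aᵀ)⁻¹ * A * Q * Aᵀ = Aᵀ := by
      calc _ = Aᵀ * ((A * Q * Aᵀ)⁻¹ * (A * Q * Aᵀ)) := by simp only [Matrix.mul_assoc]
        _ = Aᵀ := by rw [Matrix.nonsing_inv_mul _ hdet, Matrix.mul_one]
    calc _ = (Aᵀ * (A * Q * Aᵀ)⁻¹ * A * Q) *ᵥ (Aᵀ *ᵥ (A *ᵥ y)) := by rw [h1]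
      _ = y := by rw [Matrix.mulVec_mulVec, h2, h1]
  · intro hy
    rw [← hy, Matrix.mulVec_mulVec]
    simp only [← Matrix.mul_assoc]
    rw [hBA]
    simp
end

section
/- Let Q be a real symmetric positive semidefinite n×n matrix and A an m×n real matrix with orthonormal rows whose row space intersects ker Q trivially. Then ℝⁿ decomposes as the internal direct sum of the column space of Aᵀ and the kernel of the linear map x ↦ A Q x: these two subspaces intersect only in {0} and together span ℝⁿ. (P_A = Aᵀ (A Q Aᵀ)⁻¹ A Q is the oblique projection onto the column space of Aᵀ along ker(A Q).) -/
open Matrix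

/-- With `Q` real symmetric positive semidefinite, `A` with orthonormal rows and row space
intersecting `ker Q` trivially: `ℝⁿ` decomposes as the internal direct sum of the column
space of `Aᵀ` and the kernel of `x ↦ A Q x`: these subspaces intersect only in `{0}` and
together span `ℝⁿ`. -/
theorem colSpace_ker_direct_sum
    {n m : ℕ} (Q : Matrix (Fin n) (Fin n) ℝ) (A : Matrix (Fin m) (Fin n) ℝ)
    (hQsymm : Q.IsSymm) (hQ : Q.PosSemidef)
    (hA : A * Aᵀ = 1)
    (hker : LinearMap.range Aᵀ.mulVecLin ⊓ LinearMap.ker Q.mulVecLin = ⊥) :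
    LinearMap.range Aᵀ.mulVecLin ⊓ LinearMap.ker (A * Q).mulVecLin = ⊥ ∧
    LinearMap.range Aᵀ.mulVecLin ⊔ LinearMap.ker (A * Q).mulVecLin = ⊤ := by
  have h1 : LinearMap.range Aᵀ.mulVecLin ⊓ LinearMap.ker (A * Q).mulVecLin = ⊥ := by
    rw [eq_bot_iff, ← hker]
    rintro x ⟨hx, hx2⟩
    refine ⟨hx, ?_⟩
    obtain ⟨y, rfl⟩ := hx
    simp only [SetLike.mem_coe, LinearMap.mem_ker, mulVecLin_apply] at hx2 ⊢
    rw [← hQ.dotProduct_mulVec_zero_iff, star_trivial, mulVec_transpose, ← dotProduct_mulVec,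
      ← mulVec_transpose, mulVec_mulVec, hx2, dotProduct_zero]
  refine ⟨h1, Submodule.eq_top_of_disjoint _ _ ?_ (disjoint_iff.mpr h1)⟩
  have h2 := LinearMap.finrank_range_add_finrank_ker (A * Q).mulVecLin
  have h3 : (A * Q).rank ≤ Aᵀ.rank := by
    rw [rank_transpose]
    exact rank_mul_le_left A Q
  unfold Matrix.rank at h3
  omega
end
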